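/- arXiv:2408.06035 — 2 statements merged into one kernel-verified Lean document; each statement's English description precedes it below -/
import Mathlib

section
/- If P is a terminating program of the simple while-language and SymPaths_max(P) is finite, then SymPaths_max(P) is a precise and complete summary of P's executions: Traces(P) equals the union, over all (α, β) ∈ SymPaths_max(P), of the sets { the evaluation of β at σ : σ a store satisfying α }, where the evaluation of β at σ is the sequence of length |β| whose i-th store maps x to ⟦β(i)(x)⟧σ. -/
namespace HyRep

/-- A (concrete) store maps program variables to integers. -/
abbrev Store (X : Type) := X → ℤ

/-- Programs of the simple while-language (with shallowly embedded integer
and Boolean expressions over the variables `X`). -/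
inductive Prog (X : Type) : Type where
  | skip : Prog X
  | assign (x : X) (e : Store X → ℤ) : Prog X
  | ite (b : Store X → Bool) (p q : Prog X) : Prog X
  | whileLoop (b : Store X → Bool) (p : Prog X) : Prog X
  | seq (p q : Prog X) : Prog X
  | observe : Prog X

/-- A configuration is a program together with a store. -/
abbrev Config (X : Type) := Prog X × Store X

/-- The labelled small-step semantics: the label `none` is the silent label ε,
while `some σ` is the observation of the store `σ` (emitted by `observe`). -/
inductive Step {X : Type} [DecidableEq X] :
    Config X → Option (Store X) → Config X → Prop where
  | assign {x : X} {e : Store X → ℤ} {σ : Store X} :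
      Step (.assign x e, σ) none (.skip, Function.update σ x (e σ))
  | observe {σ : Store X} : Step (.observe, σ) (some σ) (.skip, σ)
  | iteTrue {b : Store X → Bool} {p q : Prog X} {σ : Store X} (h : b σ = true) :
      Step (.ite b p q, σ) none (p, σ)
  | iteFalse {b : Store X → Bool} {p q : Prog X} {σ : Store X} (h : b σ = false) :
      Step (.ite b p q, σ) none (q, σ)
  | whileTrue {b : Store X → Bool} {p : Prog X} {σ : Store X} (h : b σ = true) :
      Step (.whileLoop b p, σ) none (.seq p (.whileLoop b p), σ)
  | whileFalse {b : Store X → Bool} {p : Prog X} {σ : Store X} (h : b σ = false) :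
      Step (.whileLoop b p, σ) none (.skip, σ)
  | seqSkip {p : Prog X} {σ : Store X} : Step (.seq .skip p, σ) none (p, σ)
  | seqStep {p p' q : Prog X} {σ σ' : Store X} {μ : Option (Store X)}
      (h : Step (p, σ) μ (p', σ')) : Step (.seq p q, σ) μ (.seq p' q, σ')

/-- An execution from configuration `C`: a (finite or infinite) sequence of
labelled small steps.  `len : ℕ∞` is the number of steps; `cfg i` is the `i`-th
configuration and `lbl i` the label of the step from `cfg i` to `cfg (i+1)`
(the values of `cfg`/`lbl` beyond `len` are irrelevant). -/
structure Exec {X : Type} [DecidableEq X] (C : Config X) where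
  len : ℕ∞
  cfg : ℕ → Config X
  lbl : ℕ → Option (Store X)
  init : cfg 0 = C
  step : ∀ i : ℕ, (i : ℕ∞) + 1 ≤ len → Step (cfg i) (lbl i) (cfg (i + 1))

/-- An execution is maximal if it is infinite or ends in a configuration whose
program component is `skip`. -/
def Exec.Maximal {X : Type} [DecidableEq X] {C : Config X} (ρ : Exec C) : Prop :=
  ρ.len = ⊤ ∨ ∃ n : ℕ, ρ.len = (n : ℕ∞) ∧ (ρ.cfg n).1 = Prog.skip

/-- The indices (within the length of the execution) at which an observation
(a non-ε label) is emitted. -/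
def Exec.ObsIdx {X : Type} [DecidableEq X] {C : Config X} (ρ : Exec C) : ℕ → Prop :=
  fun i => (i : ℕ∞) + 1 ≤ ρ.len ∧ (ρ.lbl i).isSome

/-- A (finite or infinite) trace: a sequence of stores of length `len`
(values of `get` beyond `len` are irrelevant). -/
structure Trace (X : Type) where
  len : ℕ∞
  get : ℕ → Store X

open Classical in
/-- The observation sequence of an execution: the sequence of observed stores,
obtained by removing all ε labels. -/
noncomputable def Exec.obs {X : Type} [DecidableEq X] {C : Config X}
    (ρ : Exec C) : Trace X where
  len := if h : {i | ρ.ObsIdx i}.Finite then (h.toFinset.card : ℕ∞) else ⊤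
  get := fun k => (ρ.lbl (Nat.nth ρ.ObsIdx k)).getD (fun _ => 0)

open Classical in
/-- The observation sequence `obs(P, σ)` along the (unique) maximal execution
from `⟨P, σ⟩`. -/
noncomputable def obsTrace {X : Type} [DecidableEq X] (P : Prog X) (σ : Store X) :
    Trace X :=
  if h : ∃ ρ : Exec (P, σ), ρ.Maximal then h.choose.obs else ⟨0, fun _ _ => 0⟩

/-- `Traces(P)`: the set of observation sequences of maximal executions of `P`. -/
def Traces {X : Type} [DecidableEq X] (P : Prog X) : Set (Trace X) :=
  { t | ∃ (σ : Store X) (ρ : Exec (P, σ)), ρ.Maximal ∧ t = ρ.obs }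

/-- A program is terminating if all of its (maximal) executions are finite. -/
def Terminating {X : Type} [DecidableEq X] (P : Prog X) : Prop :=
  ∀ (σ : Store X) (ρ : Exec (P, σ)), ρ.Maximal → ∃ n : ℕ, ρ.len = (n : ℕ∞)

/-! ### Symbolic execution -/

/-- A symbolic store maps each variable to an (integer) expression over `X`. -/
abbrev SymStore (X : Type) := X → Store X → ℤ

/-- A path condition: a first-order condition on stores. -/
abbrev PathCond (X : Type) := Store X → Prop

/-- Symbolic configurations `⟨P, ν, α, β⟩`. -/
abbrev SymConfig (X : Type) := Prog X × SymStore X × PathCond X × List (SymStore X)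

/-- Substitute the symbolic store `ν` into the integer expression `e`. -/
def symEvalA {X : Type} (e : Store X → ℤ) (ν : SymStore X) : Store X → ℤ :=
  fun σ => e fun x => ν x σ

/-- Substitute the symbolic store `ν` into the Boolean expression `b`. -/
def symEvalB {X : Type} (b : Store X → Bool) (ν : SymStore X) : Store X → Bool :=
  fun σ => b fun x => ν x σ

/-- Small-step symbolic execution. -/
inductive SymStep {X : Type} [DecidableEq X] : SymConfig X → SymConfig X → Prop where
  | assign {x : X} {e : Store X → ℤ} {ν : SymStore X} {α : PathCond X}
      {β : List (SymStore X)} :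
      SymStep (.assign x e, ν, α, β) (.skip, Function.update ν x (symEvalA e ν), α, β)
  | observe {ν : SymStore X} {α : PathCond X} {β : List (SymStore X)} :
      SymStep (.observe, ν, α, β) (.skip, ν, α, β ++ [ν])
  | iteTrue {b : Store X → Bool} {p q : Prog X} {ν : SymStore X} {α : PathCond X}
      {β : List (SymStore X)} :
      SymStep (.ite b p q, ν, α, β) (p, ν, fun σ => α σ ∧ symEvalB b ν σ = true, β)
  | iteFalse {b : Store X → Bool} {p q : Prog X} {ν : SymStore X} {α : PathCond X}
      {β : List (SymStore X)} :
      SymStep (.ite b p q, ν, α, β) (q, ν, fun σ => α σ ∧ symEvalB b ν σ = false, β)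
  | whileTrue {b : Store X → Bool} {p : Prog X} {ν : SymStore X} {α : PathCond X}
      {β : List (SymStore X)} :
      SymStep (.whileLoop b p, ν, α, β)
        (.seq p (.whileLoop b p), ν, fun σ => α σ ∧ symEvalB b ν σ = true, β)
  | whileFalse {b : Store X → Bool} {p : Prog X} {ν : SymStore X} {α : PathCond X}
      {β : List (SymStore X)} :
      SymStep (.whileLoop b p, ν, α, β) (.skip, ν, fun σ => α σ ∧ symEvalB b ν σ = false, β)
  | seqSkip {p : Prog X} {ν : SymStore X} {α : PathCond X} {β : List (SymStore X)} :
      SymStep (.seq .skip p, ν, α, β) (p, ν, α, β)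
  | seqStep {p p' q : Prog X} {ν ν' : SymStore X} {α α' : PathCond X}
      {β β' : List (SymStore X)} (h : SymStep (p, ν, α, β) (p', ν', α', β')) :
      SymStep (.seq p q, ν, α, β) (.seq p' q, ν', α', β')

/-- The initial symbolic store `ν₀`, mapping each variable to itself. -/
def initSym {X : Type} : SymStore X := fun x σ => σ x

/-- A symbolic path: a path condition together with a symbolic observation sequence. -/
abbrev SymPath (X : Type) := PathCond X × List (SymStore X)

/-- `(α, β)` is a symbolic path of `P`: it is reached by some finite symbolic
execution starting from `⟨P, ν₀, true, ε⟩`. -/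
def IsSymPath {X : Type} [DecidableEq X] (P : Prog X) (p : SymPath X) : Prop :=
  ∃ (P' : Prog X) (ν : SymStore X),
    Relation.ReflTransGen SymStep (P, initSym, fun _ => True, []) (P', ν, p.1, p.2)

/-- `(α, β)` is a maximal symbolic path of `P`: the reached program is `skip`. -/
def IsMaxSymPath {X : Type} [DecidableEq X] (P : Prog X) (p : SymPath X) : Prop :=
  ∃ ν : SymStore X,
    Relation.ReflTransGen SymStep (P, initSym, fun _ => True, []) (.skip, ν, p.1, p.2)

/-- `SymPaths(P)`: all satisfiable symbolic paths of `P`. -/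
def SymPaths {X : Type} [DecidableEq X] (P : Prog X) : Set (SymPath X) :=
  { p | IsSymPath P p ∧ ∃ σ : Store X, p.1 σ }

/-- `SymPaths_max(P)`: all satisfiable maximal symbolic paths of `P`. -/
def SymPathsMax {X : Type} [DecidableEq X] (P : Prog X) : Set (SymPath X) :=
  { p | IsMaxSymPath P p ∧ ∃ σ : Store X, p.1 σ }

/-- Evaluate a symbolic observation sequence at a concrete store,
yielding a concrete observation sequence (a list of stores). -/
def evalObs {X : Type} (β : List (SymStore X)) (σ : Store X) : List (Store X) :=
  β.map fun ν x => ν x σ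

/-- Evaluate a symbolic observation sequence at a concrete store, as a trace. -/
def evalTrace {X : Type} (β : List (SymStore X)) (σ : Store X) : Trace X :=
  ⟨(β.length : ℕ∞), fun i x => (β.getD i initSym) x σ⟩

/-! ### HyperLTL -/

/-- Bodies of HyperLTL formulas over `n` trace variables: atoms are (shallowly
embedded) first-order predicates over the indexed variables `x_{π_j}` (i.e.,
predicates over one store per trace variable); negation occurs only inside
atoms, and the temporal operators are next `X` and weak-until `W`. -/
inductive LTLBody (X : Type) : ℕ → Type 1 where
  | atom {n : ℕ} (θ : (Fin n → Store X) → Prop) : LTLBody X n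
  | and {n : ℕ} (ψ₁ ψ₂ : LTLBody X n) : LTLBody X n
  | or {n : ℕ} (ψ₁ ψ₂ : LTLBody X n) : LTLBody X n
  | next {n : ℕ} (ψ : LTLBody X n) : LTLBody X n
  | wuntil {n : ℕ} (ψ₁ ψ₂ : LTLBody X n) : LTLBody X n

/-- Vacuous satisfaction: some bound trace is shorter than the current position. -/
def vac {X : Type} {n : ℕ} (Tr : Fin n → Trace X) (i : ℕ) : Prop :=
  ∃ j : Fin n, (Tr j).len ≤ (i : ℕ∞)

/-- Satisfaction `Π, i ⊨ ψ` of an LTL body on a trace assignment `Tr`. -/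
def BodySat {X : Type} {n : ℕ} (Tr : Fin n → Trace X) : LTLBody X n → ℕ → Prop
  | .atom θ => fun i => vac Tr i ∨ θ fun j => (Tr j).get i
  | .and ψ₁ ψ₂ => fun i => vac Tr i ∨ (BodySat Tr ψ₁ i ∧ BodySat Tr ψ₂ i)
  | .or ψ₁ ψ₂ => fun i => vac Tr i ∨ (BodySat Tr ψ₁ i ∨ BodySat Tr ψ₂ i)
  | .next ψ => fun i => vac Tr i ∨ BodySat Tr ψ (i + 1)
  | .wuntil ψ₁ ψ₂ => fun i => vac Tr i ∨
      ((∃ j : ℕ, i ≤ j ∧ BodySat Tr ψ₂ j ∧ ∀ k : ℕ, i ≤ k → k < j → BodySat Tr ψ₁ k) ∨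
        ∀ j : ℕ, i ≤ j → BodySat Tr ψ₁ j)

/-- HyperLTL formulas: a quantifier prefix over trace variables followed by an
LTL body; `HyperLTL X n` has `n` already-bound (outer) trace variables. -/
inductive HyperLTL (X : Type) : ℕ → Type 1 where
  | body {n : ℕ} (ψ : LTLBody X n) : HyperLTL X n
  | uall {n : ℕ} (φ : HyperLTL X (n + 1)) : HyperLTL X n
  | uex {n : ℕ} (φ : HyperLTL X (n + 1)) : HyperLTL X n

/-- HyperLTL satisfaction `Π, 0 ⊨_T φ`, with quantifiers ranging over `T`. -/
def HSat {X : Type} (T : Set (Trace X)) :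
    {n : ℕ} → HyperLTL X n → (Fin n → Trace X) → Prop
  | _, .body ψ, Tr => BodySat Tr ψ 0
  | _, .uall φ, Tr => ∀ t ∈ T, HSat T φ (Fin.snoc Tr t)
  | _, .uex φ, Tr => ∃ t ∈ T, HSat T φ (Fin.snoc Tr t)

/-- `P ⊨ φ`, i.e., `∅, 0 ⊨_{Traces(P)} φ`. -/
def Sat {X : Type} [DecidableEq X] (P : Prog X) (φ : HyperLTL X 0) : Prop :=
  HSat (Traces P) φ Fin.elim0

/-- The formula is a `∀*` formula (all quantifiers universal). -/
def IsUniv {X : Type} : {n : ℕ} → HyperLTL X n → Prop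
  | _, .body _ => True
  | _, .uall φ => IsUniv φ
  | _, .uex _ => False

/-- The formula is an `∃*` formula (all quantifiers existential). -/
def IsExist {X : Type} : {n : ℕ} → HyperLTL X n → Prop
  | _, .body _ => True
  | _, .uall _ => False
  | _, .uex φ => IsExist φ

/-- Satisfaction of the `∀ⁿ` HyperLTL formula `∀π₁…∀πₙ. ψ` by program `P`. -/
def SatAll {X : Type} [DecidableEq X] (P : Prog X) {n : ℕ} (ψ : LTLBody X n) : Prop :=
  ∀ Tr : Fin n → Trace X, (∀ j, Tr j ∈ Traces P) → BodySat Tr ψ 0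

/-! ### The encodings -/

/-- The encoding `enc^φ_Ps`: each trace quantifier is resolved on the symbolic
paths in `Ps` (introducing a fresh copy of the program variables, i.e., a store,
and asserting the path condition on it); the body case asserts `acc^ψ_Δ`,
i.e., that the instantiated symbolic observation sequences satisfy `ψ`. -/
def enc {X : Type} (Ps : Set (SymPath X)) :
    {n : ℕ} → HyperLTL X n → (Fin n → Store X) → (Fin n → List (SymStore X)) → Prop
  | _, .body ψ, v, Δ => BodySat (fun j => evalTrace (Δ j) (v j)) ψ 0
  | _, .uall φ, v, Δ => ∀ σ : Store X, ∀ p ∈ Ps, p.1 σ →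
      enc Ps φ (Fin.snoc v σ) (Fin.snoc Δ p.2)
  | _, .uex φ, v, Δ => ∃ σ : Store X, ∃ p ∈ Ps, p.1 σ ∧
      enc Ps φ (Fin.snoc v σ) (Fin.snoc Δ p.2)

/-- The encoding `enc^φ_Ps` for the `∀ⁿ` formula `∀π₁…∀πₙ. ψ`. -/
def encAll {X : Type} {n : ℕ} (ψ : LTLBody X n) (Ps : Set (SymPath X)) : Prop :=
  ∀ (σs : Fin n → Store X) (ps : Fin n → SymPath X),
    (∀ j, ps j ∈ Ps) → (∀ j, (ps j).1 (σs j)) →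
    BodySat (fun j => evalTrace (ps j).2 (σs j)) ψ 0

/-- `t ≠_{X_out} t'`: at some position within both sequences the stores
differ on some output variable. -/
def OutDiff {X : Type} (Xout : Set X) (t t' : Trace X) : Prop :=
  ∃ i : ℕ, (i : ℕ∞) < t.len ∧ (i : ℕ∞) < t'.len ∧ ∃ x ∈ Xout, t.get i x ≠ t'.get i x

/-- `Q` is a fully transparent repair of `(P, ∀π₁…∀πₙ. ψ)`. -/
def FullyTransparent {X : Type} [DecidableEq X] (Xout : Set X) {n : ℕ}
    (ψ : LTLBody X n) (P Q : Prog X) : Prop :=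
  SatAll Q ψ ∧
  ∀ σ : Store X, OutDiff Xout (obsTrace P σ) (obsTrace Q σ) →
    ∃ σs : Fin n → Store X, (∃ j, σ = σs j) ∧
      ¬ BodySat (fun j => obsTrace P (σs j)) ψ 0

/-- `Q` is a better repair than `S` w.r.t. `(P, φ)`. -/
def BetterRepair {X : Type} [DecidableEq X] (Xout : Set X) (φ : HyperLTL X 0)
    (P Q S : Prog X) : Prop :=
  Sat Q φ ∧
  (∀ σ : Store X, OutDiff Xout (obsTrace P σ) (obsTrace Q σ) →
      OutDiff Xout (obsTrace P σ) (obsTrace S σ)) ∧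
  (∃ σ : Store X, OutDiff Xout (obsTrace P σ) (obsTrace S σ) ∧
      ¬ OutDiff Xout (obsTrace P σ) (obsTrace Q σ))

/-- The encoding `trans^φ_{Ps_P, Ps_Q}` for fully transparent repair
(for `φ = ∀π₁…∀πₙ. ψ`). -/
def transEnc {X : Type} (Xout : Set X) {n : ℕ} (ψ : LTLBody X n)
    (PP PQ : Set (SymPath X)) : Prop :=
  ∀ σ : Store X,
    (∃ pP ∈ PP, ∃ pQ ∈ PQ, pP.1 σ ∧ pQ.1 σ ∧
      ∃ i < min pP.2.length pQ.2.length, ∃ x ∈ Xout,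
        (pP.2.getD i initSym) x σ ≠ (pQ.2.getD i initSym) x σ) →
    ∃ (σs : Fin n → Store X) (ps : Fin n → SymPath X),
      (∀ j, ps j ∈ PP) ∧ (∀ j, (ps j).1 (σs j)) ∧ (∃ j, σ = σs j) ∧
      ¬ BodySat (fun j => evalTrace (ps j).2 (σs j)) ψ 0

/-- The encoding `iter_{Ps_P, Ps_S, Ps_Q}` for iterative repair. -/
def iterEnc {X : Type} (Xout : Set X) (PP PS PQ : Set (SymPath X)) : Prop :=
  (∀ σ : Store X, ∀ pP ∈ PP, ∀ pS ∈ PS, ∀ pQ ∈ PQ,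
    pP.1 σ → pS.1 σ → pQ.1 σ →
    (∃ i < min pP.2.length pQ.2.length, ∃ x ∈ Xout,
        (pP.2.getD i initSym) x σ ≠ (pQ.2.getD i initSym) x σ) →
    (∃ i < min pP.2.length pS.2.length, ∃ x ∈ Xout,
        (pP.2.getD i initSym) x σ ≠ (pS.2.getD i initSym) x σ)) ∧
  (∃ σ : Store X, ∃ pP ∈ PP, ∃ pS ∈ PS, ∃ pQ ∈ PQ,
    pP.1 σ ∧ pS.1 σ ∧ pQ.1 σ ∧
    (∃ i < min pP.2.length pS.2.length, ∃ x ∈ Xout,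
        (pP.2.getD i initSym) x σ ≠ (pS.2.getD i initSym) x σ) ∧
    (∀ i < min pP.2.length pQ.2.length, ∀ x ∈ Xout,
        (pP.2.getD i initSym) x σ = (pQ.2.getD i initSym) x σ))

/-- A program is loop-free if it contains no `while` statement. -/
def LoopFree {X : Type} : Prog X → Prop
  | .skip => True
  | .assign _ _ => True
  | .observe => True
  | .ite _ p q => LoopFree p ∧ LoopFree q
  | .whileLoop _ _ => False
  | .seq p q => LoopFree p ∧ LoopFree q

/-- The concrete store denoted by the symbolic store `ν` at `σ`. -/
def evalStore {X : Type} (ν : SymStore X) (σ : Store X) : Store X := fun x => ν x σ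

theorem evalStore_update {X : Type} [DecidableEq X] (ν : SymStore X) (σ : Store X) (x : X)
    (e : Store X → ℤ) :
    evalStore (Function.update ν x (symEvalA e ν)) σ =
      Function.update (evalStore ν σ) x (e (evalStore ν σ)) := by
  funext y
  by_cases h : y = x
  · subst h
    simp only [evalStore, Function.update_self]
    rfl
  · simp [evalStore, h]

theorem evalObs_append_singleton {X : Type} (β : List (SymStore X)) (ν : SymStore X)
    (σ : Store X) : evalObs (β ++ [ν]) σ = evalObs β σ ++ [evalStore ν σ] := by
  simp only [evalObs, List.map_append]
  rfl

/-- Every concrete step is matched by a symbolic step whose path condition holds at `σ`. -/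
theorem Step.exists_symStep {X : Type} [DecidableEq X] {c c' : Config X}
    {μ : Option (Store X)} (h : Step c μ c') {ν : SymStore X} {α : PathCond X} {σ : Store X}
    (β : List (SymStore X)) (hs : c.2 = evalStore ν σ) (hα : α σ) :
    ∃ ν' α' β', SymStep (c.1, ν, α, β) (c'.1, ν', α', β') ∧ α' σ ∧
      c'.2 = evalStore ν' σ ∧ evalObs β' σ = evalObs β σ ++ μ.toList := by
  induction h with
  | assign =>
    subst hs
    exact ⟨_, _, _, .assign, hα, (evalStore_update ..).symm, by simp⟩
  | observe =>
    subst hs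
    exact ⟨_, _, _, .observe, hα, rfl, evalObs_append_singleton ..⟩
  | iteTrue h =>
    subst hs
    exact ⟨_, _, _, .iteTrue, ⟨hα, h⟩, rfl, by simp⟩
  | iteFalse h =>
    subst hs
    exact ⟨_, _, _, .iteFalse, ⟨hα, h⟩, rfl, by simp⟩
  | whileTrue h =>
    subst hs
    exact ⟨_, _, _, .whileTrue, ⟨hα, h⟩, rfl, by simp⟩
  | whileFalse h =>
    subst hs
    exact ⟨_, _, _, .whileFalse, ⟨hα, h⟩, rfl, by simp⟩
  | seqSkip => exact ⟨_, _, _, .seqSkip, hα, hs, by simp⟩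
  | seqStep _ ih =>
    obtain ⟨ν', α', β', h₁, h₂⟩ := ih hs
    exact ⟨ν', α', β', .seqStep h₁, h₂⟩

/-- Every symbolic step is matched by a concrete step from each store satisfying the
resulting path condition. -/
theorem SymStep.exists_step {X : Type} [DecidableEq X] {c c' : SymConfig X}
    (h : SymStep c c') {σ : Store X} (hα : c'.2.2.1 σ) :
    c.2.2.1 σ ∧ ∃ μ, Step (c.1, evalStore c.2.1 σ) μ (c'.1, evalStore c'.2.1 σ) ∧
      evalObs c'.2.2.2 σ = evalObs c.2.2.2 σ ++ μ.toList := by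
  induction h with
  | assign => exact ⟨hα, none, by rw [evalStore_update]; exact .assign, by simp⟩
  | observe => exact ⟨hα, _, .observe, evalObs_append_singleton ..⟩
  | iteTrue => exact ⟨hα.1, none, .iteTrue hα.2, by simp⟩
  | iteFalse => exact ⟨hα.1, none, .iteFalse hα.2, by simp⟩
  | whileTrue => exact ⟨hα.1, none, .whileTrue hα.2, by simp⟩
  | whileFalse => exact ⟨hα.1, none, .whileFalse hα.2, by simp⟩
  | seqSkip => exact ⟨hα, none, .seqSkip, by simp⟩
  | seqStep _ ih =>
    obtain ⟨h₁, μ, h₂, h₃⟩ := ih hα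
    exact ⟨h₁, μ, .seqStep h₂, h₃⟩

theorem filterMap_range_succ {A : Type*} (f : ℕ → Option A) (n : ℕ) :
    (List.range (n + 1)).filterMap f = (List.range n).filterMap f ++ (f n).toList := by
  rw [List.range_succ, List.filterMap_append]
  cases h : f n <;> simp [h]

/-- Every finite prefix of an execution from `(P, σ)` is the instance at `σ` of a symbolic
execution of `P`. -/
theorem Exec.exists_symExec {X : Type} [DecidableEq X] {P : Prog X} {σ : Store X}
    (ρ : Exec (P, σ)) (n : ℕ) (hn : (n : ℕ∞) ≤ ρ.len) :
    ∃ ν α β, Relation.ReflTransGen SymStep (P, initSym, fun _ => True, [])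
        ((ρ.cfg n).1, ν, α, β) ∧ α σ ∧ (ρ.cfg n).2 = evalStore ν σ ∧
      evalObs β σ = (List.range n).filterMap ρ.lbl := by
  induction n with
  | zero =>
    rw [ρ.init]
    exact ⟨_, _, _, .refl, trivial, rfl, rfl⟩
  | succ n ih =>
    push_cast at hn
    obtain ⟨ν, α, β, hr, hα, hs, hβ⟩ := ih (le_self_add.trans hn)
    obtain ⟨ν', α', β', hstep, hα', hs', hβ'⟩ := (ρ.step n hn).exists_symStep β hs hα
    exact ⟨ν', α', β', hr.tail hstep, hα', hs', by rw [hβ', hβ, filterMap_range_succ]⟩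

/-- The execution of length zero. -/
def Exec.nil {X : Type} [DecidableEq X] (C : Config X) : Exec C where
  len := 0
  cfg := fun _ => C
  lbl := fun _ => none
  init := rfl
  step := by simp

/-- Extension of an execution of length `n` by one step. -/
def Exec.snoc {X : Type} [DecidableEq X] {C C' : Config X} (ρ : Exec C) {n : ℕ}
    {μ : Option (Store X)} (hn : ρ.len = n) (h : Step (ρ.cfg n) μ C') : Exec C where
  len := (n + 1 : ℕ)
  cfg := Function.update ρ.cfg (n + 1) C'
  lbl := Function.update ρ.lbl n μ
  init := by simp [ρ.init]
  step := by
    intro i hi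
    have hi' : i ≤ n := by
      have : i + 1 ≤ n + 1 := by exact_mod_cast hi
      omega
    rcases hi'.eq_or_lt with rfl | hlt
    · simpa using h
    · have hle : (i : ℕ∞) + 1 ≤ ρ.len := by
        rw [hn]
        exact_mod_cast hlt
      rw [Function.update_of_ne (by omega), Function.update_of_ne (by omega),
        Function.update_of_ne (by omega)]
      exact ρ.step i hle

theorem filterMap_range_update {A : Type*} (f : ℕ → Option A) (n : ℕ) (a : Option A) :
    (List.range (n + 1)).filterMap (Function.update f n a) =
      (List.range n).filterMap f ++ a.toList := by
  rw [filterMap_range_succ, Function.update_self]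
  congr 1
  refine List.filterMap_congr fun i hi => ?_
  exact Function.update_of_ne (List.mem_range.mp hi).ne _ _

/-- Every symbolic execution of `P` is realised concretely from each store satisfying its
path condition. -/
theorem exists_exec_of_symExec {X : Type} [DecidableEq X] {P : Prog X} {c : SymConfig X}
    (h : Relation.ReflTransGen SymStep (P, initSym, fun _ => True, []) c) {σ : Store X}
    (hα : c.2.2.1 σ) :
    ∃ (ρ : Exec (P, σ)) (n : ℕ), ρ.len = n ∧ ρ.cfg n = (c.1, evalStore c.2.1 σ) ∧
      (List.range n).filterMap ρ.lbl = evalObs c.2.2.2 σ := by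
  induction h with
  | refl => exact ⟨.nil _, 0, rfl, rfl, rfl⟩
  | tail _ hstep ih =>
    obtain ⟨hα', μ, hμ, hobs⟩ := hstep.exists_step hα
    obtain ⟨ρ, n, hn, hcfg, hlbl⟩ := ih hα'
    rw [← hcfg] at hμ
    refine ⟨ρ.snoc hn hμ, n + 1, rfl, Function.update_self .., ?_⟩
    rw [hobs, ← hlbl]
    exact filterMap_range_update ..

/-- If `P` is terminating and `SymPaths_max(P)` is finite, then
the symbolic paths are a precise and complete summary of `P`'s executions:
`Traces(P)` (here: the set of finite observation sequences of maximal
executions, which are all of them since `P` terminates) equals the union, over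
`(α, β) ∈ SymPaths_max(P)`, of the evaluations of `β` at stores satisfying `α`. -/
theorem symbolic_paths_summary {X : Type} [DecidableEq X]
    (P : Prog X) (hterm : Terminating P) (hfin : (SymPathsMax P).Finite) :
    { t : List (Store X) | ∃ (σ : Store X) (ρ : Exec (P, σ)) (n : ℕ),
        ρ.Maximal ∧ ρ.len = (n : ℕ∞) ∧ t = (List.range n).filterMap ρ.lbl } =
    { t : List (Store X) | ∃ p ∈ SymPathsMax P, ∃ σ : Store X,
        p.1 σ ∧ t = evalObs p.2 σ } := by
  ext t
  constructor
  · rintro ⟨σ, ρ, n, hmax, hn, rfl⟩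
    obtain ⟨ν, α, β, hr, hα, -, hβ⟩ := ρ.exists_symExec n hn.ge
    have hskip : (ρ.cfg n).1 = .skip := by
      rcases hmax with h | ⟨m, hm, h⟩
      · simp [hn] at h
      · obtain rfl : n = m := by exact_mod_cast hn.symm.trans hm
        exact h
    rw [hskip] at hr
    exact ⟨(α, β), ⟨⟨ν, hr⟩, σ, hα⟩, σ, hα, hβ.symm⟩
  · rintro ⟨⟨α, β⟩, ⟨⟨ν, hr⟩, -⟩, σ, hα, rfl⟩
    obtain ⟨ρ, n, hn, hcfg, hlbl⟩ := exists_exec_of_symExec hr hα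
    exact ⟨σ, ρ, n, .inr ⟨n, hn, by rw [hcfg]⟩, hn, hlbl.symm⟩


end HyRep
end

section
/- (Proposition 2.) Let φ be an ∃* HyperLTL formula (all quantifiers existential) and let 𝒫 ⊆ SymPaths_max(Q) be a finite set of satisfiable maximal symbolic paths of a program Q. If the formula enc^φ_𝒫 is valid, then Q ⊨ φ. -/
namespace HyRep

/-- Two traces agree if they have the same length and the same stores within it. -/
def Trace.Agree {X : Type} (t t' : Trace X) : Prop :=
  t.len = t'.len ∧ ∀ k : ℕ, (k : ℕ∞) < t.len → t.get k = t'.get k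

theorem vac_congr {X : Type} {n : ℕ} {Tr Tr' : Fin n → Trace X}
    (h : ∀ j, (Tr j).Agree (Tr' j)) (i : ℕ) : vac Tr i ↔ vac Tr' i :=
  exists_congr fun j => by rw [(h j).1]

theorem bodySat_congr {X : Type} {n : ℕ} {Tr Tr' : Fin n → Trace X}
    (h : ∀ j, (Tr j).Agree (Tr' j)) (ψ : LTLBody X n) :
    ∀ i, BodySat Tr ψ i ↔ BodySat Tr' ψ i := by
  induction ψ with
  | atom θ =>
    intro i
    simp only [BodySat, ← vac_congr h i]
    by_cases hv : vac Tr i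
    · simp [hv]
    · have hget : (fun j => (Tr j).get i) = fun j => (Tr' j).get i :=
        funext fun j => (h j).2 i (not_le.1 fun hle => hv ⟨j, hle⟩)
      rw [hget]
  | and ψ₁ ψ₂ ih₁ ih₂ => intro i; simp only [BodySat, vac_congr h, ih₁, ih₂]
  | or ψ₁ ψ₂ ih₁ ih₂ => intro i; simp only [BodySat, vac_congr h, ih₁, ih₂]
  | next ψ ih => intro i; simp only [BodySat, vac_congr h, ih]
  | wuntil ψ₁ ψ₂ ih₁ ih₂ => intro i; simp only [BodySat, vac_congr h, ih₁, ih₂]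

/-- A symbolic step whose resulting path condition holds at `σ` is matched by a concrete step. -/
theorem SymStep.exists_step_s7 {X : Type} [DecidableEq X] (σ : Store X) {P P' : Prog X}
    {ν ν' : SymStore X} {α α' : PathCond X} {β β' : List (SymStore X)}
    (h : SymStep (P, ν, α, β) (P', ν', α', β')) (hα : α' σ) :
    α σ ∧ ∃ μ, Step (P, fun x => ν x σ) μ (P', fun x => ν' x σ) ∧
      evalObs β' σ = evalObs β σ ++ μ.toList := by
  induction P generalizing P' with
  | skip => cases h
  | assign x e =>
    cases h
    refine ⟨hα, none, ?_, by simp⟩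
    have hupd : (fun y => Function.update ν x (symEvalA e ν) y σ) =
        Function.update (fun y => ν y σ) x (e fun y => ν y σ) := by
      funext y
      by_cases hy : y = x
      · subst hy; simp [symEvalA]
      · simp [hy]
    rw [hupd]
    exact .assign
  | ite b p q =>
    cases h with
    | iteTrue => exact ⟨hα.1, none, .iteTrue hα.2, by simp⟩
    | iteFalse => exact ⟨hα.1, none, .iteFalse hα.2, by simp⟩
  | whileLoop b p =>
    cases h with
    | whileTrue => exact ⟨hα.1, none, .whileTrue hα.2, by simp⟩
    | whileFalse => exact ⟨hα.1, none, .whileFalse hα.2, by simp⟩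
  | seq p q ihp =>
    cases h with
    | seqSkip => exact ⟨hα, none, .seqSkip, by simp⟩
    | seqStep h =>
      obtain ⟨h₁, μ, h₂, h₃⟩ := ihp h
      exact ⟨h₁, μ, .seqStep h₂, h₃⟩
  | observe =>
    cases h
    exact ⟨hα, some _, .observe, by simp [evalObs]⟩

/-- Every symbolic path whose condition holds at `σ` is matched by a finite execution from `σ`. -/
theorem exists_exec_of_symPath {X : Type} [DecidableEq X] {Q : Prog X} (σ : Store X)
    {C : SymConfig X}
    (h : Relation.ReflTransGen SymStep (Q, initSym, fun _ => True, []) C) (hα : C.2.2.1 σ) :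
    ∃ (n : ℕ) (ρ : Exec (Q, σ)), ρ.len = n ∧ ρ.cfg n = (C.1, fun x => C.2.1 x σ) ∧
      (List.range n).filterMap ρ.lbl = evalObs C.2.2.2 σ := by
  induction h with
  | refl =>
    exact ⟨0, ⟨0, fun _ => (Q, σ), fun _ => none, rfl, by simp⟩, rfl, rfl, rfl⟩
  | @tail C C' _ hstep ih =>
    obtain ⟨P, ν, α, β⟩ := C
    obtain ⟨P', ν', α', β'⟩ := C'
    obtain ⟨hα₀, μ, hμ, hβ⟩ := hstep.exists_step_s7 σ hα
    obtain ⟨n, ρ, hlen, hcfg, hobs⟩ := ih hα₀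
    refine ⟨n + 1, ⟨(n + 1 : ℕ), Function.update ρ.cfg (n + 1) (P', fun x => ν' x σ),
      Function.update ρ.lbl n μ, ?_, ?_⟩, rfl, by simp, ?_⟩
    · simpa using ρ.init
    · intro i hi
      have hi' : i < n + 1 := by exact_mod_cast hi
      rcases (Nat.lt_succ_iff.1 hi').lt_or_eq with hlt | rfl
      · rw [Function.update_of_ne (by omega), Function.update_of_ne hlt.ne,
          Function.update_of_ne (by omega)]
        exact ρ.step i (by rw [hlen]; exact_mod_cast hlt)
      · rw [Function.update_of_ne (by omega), Function.update_self, Function.update_self, hcfg]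
        exact hμ
    · have hpre : (List.range n).filterMap (Function.update ρ.lbl n μ) =
          (List.range n).filterMap ρ.lbl :=
        List.filterMap_congr fun i hi =>
          Function.update_of_ne (List.mem_range.1 hi).ne _ _
      simp only [List.range_succ, List.filterMap_append, hpre]
      rw [hobs, hβ]
      cases μ <;> simp

theorem length_filterMap_range {A : Type*} (f : ℕ → Option A) (n : ℕ) :
    ((List.range n).filterMap f).length = Nat.count (fun i => (f i).isSome) n := by
  induction n with
  | zero => simp
  | succ n ih =>
    rw [List.range_succ, List.filterMap_append, List.length_append, ih, Nat.count_succ]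
    cases h : f n <;> simp [h]

theorem getElem?_filterMap_range {A : Type*} {f : ℕ → Option A} {n i : ℕ} (hi : i < n) {a : A}
    (ha : f i = some a) :
    ((List.range n).filterMap f)[Nat.count (fun i => (f i).isSome) i]? = some a := by
  induction n with
  | zero => omega
  | succ n ih =>
    rw [List.range_succ, List.filterMap_append]
    rcases (Nat.lt_succ_iff.1 hi).lt_or_eq with hlt | rfl
    · exact List.getElem?_append_left (List.getElem?_eq_some_iff.1 (ih hlt)).1 ▸ ih hlt
    · rw [List.getElem?_append_right (length_filterMap_range f i).le, length_filterMap_range]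
      simp [ha]

theorem Exec.obsIdx_iff {X : Type} [DecidableEq X] {C : Config X} {ρ : Exec C} {n : ℕ}
    (hlen : ρ.len = n) (i : ℕ) : ρ.ObsIdx i ↔ i < n ∧ (ρ.lbl i).isSome := by
  rw [Exec.ObsIdx, hlen]
  exact and_congr_left fun _ => by norm_cast

open Classical in
theorem Exec.count_obsIdx {X : Type} [DecidableEq X] {C : Config X} {ρ : Exec C} {n i : ℕ}
    (hlen : ρ.len = n) (hi : i ≤ n) :
    Nat.count ρ.ObsIdx i = Nat.count (fun i => (ρ.lbl i).isSome) i := by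
  rw [Nat.count_eq_card_filter_range, Nat.count_eq_card_filter_range]
  congr 1
  refine Finset.filter_congr fun k hk => ?_
  rw [Exec.obsIdx_iff hlen]
  exact and_iff_right ((Finset.mem_range.1 hk).trans_le hi)

open Classical in
/-- The observations of a finite execution, as a list of stores. -/
theorem Exec.obs_of_finite {X : Type} [DecidableEq X] {C : Config X} {ρ : Exec C} {n : ℕ}
    (hlen : ρ.len = n) :
    ρ.obs.len = ((List.range n).filterMap ρ.lbl).length ∧
      ∀ k : ℕ, (k : ℕ∞) < ρ.obs.len →
        ((List.range n).filterMap ρ.lbl)[k]? = some (ρ.obs.get k) := by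
  have hfin : {i | ρ.ObsIdx i}.Finite :=
    (Set.finite_lt_nat n).subset fun i hi => ((Exec.obsIdx_iff hlen i).1 hi).1
  have hcard : hfin.toFinset.card = ((List.range n).filterMap ρ.lbl).length := by
    rw [length_filterMap_range, ← Exec.count_obsIdx hlen le_rfl, Nat.count_eq_card_filter_range]
    congr 1
    ext i
    simpa using fun hi => ((Exec.obsIdx_iff hlen i).1 hi).1
  have hobs : ρ.obs.len = (hfin.toFinset.card : ℕ∞) := dif_pos hfin
  refine ⟨by rw [hobs, hcard], fun k hk => ?_⟩
  have hk' : ∀ hf : {i | ρ.ObsIdx i}.Finite, k < hf.toFinset.card := fun _ => by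
    rw [hobs] at hk
    exact_mod_cast hk
  obtain ⟨hi, hsome⟩ := (Exec.obsIdx_iff hlen _).1 (Nat.nth_mem k hk')
  obtain ⟨s, hs⟩ := Option.isSome_iff_exists.1 hsome
  have hget := getElem?_filterMap_range hi hs
  rw [← Exec.count_obsIdx hlen hi.le, Nat.count_nth hk'] at hget
  rw [hget]
  simp [Exec.obs, hs]

/-- A maximal symbolic path, evaluated at a store satisfying its condition, agrees with a trace. -/
theorem exists_trace_agree {X : Type} [DecidableEq X] {Q : Prog X} {p : SymPath X}
    (hp : IsMaxSymPath Q p) {σ : Store X} (hσ : p.1 σ) :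
    ∃ t ∈ Traces Q, t.Agree (evalTrace p.2 σ) := by
  obtain ⟨ν, hν⟩ := hp
  obtain ⟨n, ρ, hlen, hcfg, hβ⟩ := exists_exec_of_symPath σ hν hσ
  obtain ⟨hl, hg⟩ := Exec.obs_of_finite hlen
  rw [hβ] at hl hg
  refine ⟨ρ.obs, ⟨σ, ρ, .inr ⟨n, hlen, by rw [hcfg]⟩, rfl⟩, by simpa [evalObs, evalTrace] using hl,
    fun k hk => ?_⟩
  have hgk := hg k hk
  simp only [evalObs, List.getElem?_map, Option.map_eq_some_iff] at hgk
  obtain ⟨τ, hτ, hget⟩ := hgk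
  rw [← hget]
  simp [evalTrace, List.getD_eq_getElem?_getD, hτ]

theorem hSat_of_enc {X : Type} [DecidableEq X] {Q : Prog X} {Ps : Set (SymPath X)}
    (hsub : Ps ⊆ SymPathsMax Q) {n : ℕ} (φ : HyperLTL X n) (hex : IsExist φ)
    {v : Fin n → Store X} {Δ : Fin n → List (SymStore X)} {Tr : Fin n → Trace X}
    (hTr : ∀ j, (Tr j).Agree (evalTrace (Δ j) (v j))) (henc : enc Ps φ v Δ) :
    HSat (Traces Q) φ Tr := by
  induction φ with
  | body ψ => exact (bodySat_congr hTr ψ 0).2 henc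
  | uall φ => exact hex.elim
  | uex φ ih =>
    obtain ⟨σ, p, hp, hσ, henc⟩ := henc
    obtain ⟨t, ht, hagree⟩ := exists_trace_agree (hsub hp).1 hσ
    refine ⟨t, ht, ih hex (fun j => ?_) henc⟩
    refine Fin.lastCases ?_ (fun j => ?_) j
    · simpa using hagree
    · simpa using hTr j

/-- Proposition 2. For an `∃*` HyperLTL formula `φ` and a
finite set `𝒫 ⊆ SymPaths_max(Q)` of satisfiable maximal symbolic paths:
if `enc^φ_𝒫` is valid then `Q ⊨ φ`. -/
theorem enc_exists_sound {X : Type} [DecidableEq X] (Q : Prog X)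
    (φ : HyperLTL X 0) (hex : IsExist φ) (Ps : Set (SymPath X))
    (hsub : Ps ⊆ SymPathsMax Q) (hfin : Ps.Finite)
    (henc : enc Ps φ Fin.elim0 Fin.elim0) : Sat Q φ := by
  exact hSat_of_enc hsub φ hex (fun j => j.elim0) henc

end HyRep
end
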